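/- For symmetric matrices A satisfying |γA − I_n| ≤ √(1−δ) pointwise a.e. (with γ bounded measurable, δ ∈ (0,1]), and any φ ∈ H²_per(Y), the bilinear form b₀(φ,φ) := (−γA:D²φ, −Δφ)_{L²(Y)} satisfies ‖Δφ‖²_{L²(Y)} ≤ C_δ b₀(φ,φ) with C_δ = (1 − √(1−δ))⁻¹. -/

import Mathlib

open MeasureTheory

/-- Partial derivative in the `i`-th coordinate direction. -/
noncomputable def pd {n : ℕ} (i : Fin n) (f : (Fin n → ℝ) → ℝ) : (Fin n → ℝ) → ℝ :=
  fun x => fderiv ℝ f x (Pi.single i 1)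

/-- The Laplacian. -/
noncomputable def lap {n : ℕ} (f : (Fin n → ℝ) → ℝ) : (Fin n → ℝ) → ℝ :=
  fun x => ∑ i, pd i (pd i f) x

/-- The unit cell `Y = (0,1)ⁿ`. -/
def UnitCell (n : ℕ) : Set (Fin n → ℝ) := Set.univ.pi fun _ => Set.Ioo (0:ℝ) 1

/-- `Y`-periodicity (`Y = (0,1)ⁿ`). -/
def PeriodicFn {n : ℕ} (f : (Fin n → ℝ) → ℝ) : Prop :=
  ∀ (x : Fin n → ℝ) (i : Fin n), f (x + Pi.single i 1) = f x

lemma pd_contDiff {n : ℕ} (i : Fin n) {f : (Fin n → ℝ) → ℝ} (hf : ContDiff ℝ (⊤ : ℕ∞) f) :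
    ContDiff ℝ (⊤ : ℕ∞) (pd i f) := by
  unfold pd
  exact (hf.fderiv_right (m := (⊤ : ℕ∞)) (by simp)).clm_apply contDiff_const

lemma pd_periodic {n : ℕ} (i : Fin n) {f : (Fin n → ℝ) → ℝ} (hf : PeriodicFn f) :
    PeriodicFn (pd i f) := by
  intro x j
  have h : (fun y => f (y + Pi.single j 1)) = f := funext fun y => hf y j
  unfold pd
  rw [← fderiv_comp_add_right, h]

lemma pd_mul {n : ℕ} (i : Fin n) {f g : (Fin n → ℝ) → ℝ} (hf : ContDiff ℝ (⊤ : ℕ∞) f)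
    (hg : ContDiff ℝ (⊤ : ℕ∞) g) (x : Fin n → ℝ) :
    pd i (fun y => f y * g y) x = f x * pd i g x + pd i f x * g x := by
  have h1 := (hf.differentiable (by simp)) x
  have h2 := (hg.differentiable (by simp)) x
  unfold pd
  rw [fderiv_fun_mul h1 h2]
  simp [mul_comm]

lemma pd_comm {n : ℕ} (i j : Fin n) {f : (Fin n → ℝ) → ℝ} (hf : ContDiff ℝ (⊤ : ℕ∞) f) :
    pd i (pd j f) = pd j (pd i f) := by
  funext x
  have hs : IsSymmSndFDerivAt ℝ f x :=
    hf.contDiffAt.isSymmSndFDerivAt (by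
      rw [minSmoothness_of_isRCLikeNormedField]
      exact WithTop.coe_le_coe.2 (le_top : (2 : ℕ∞) ≤ ⊤))
  have hd : DifferentiableAt ℝ (fderiv ℝ f) x :=
    ((hf.fderiv_right (m := (⊤ : ℕ∞)) (by simp)).differentiable (by simp)) x
  have key : ∀ a b : Fin n, pd a (pd b f) x
      = fderiv ℝ (fderiv ℝ f) x (Pi.single a 1) (Pi.single b 1) := by
    intro a b
    unfold pd
    rw [fderiv_clm_apply hd (differentiableAt_const _)]
    simp
  rw [key, key]
  exact hs _ _

lemma unitCell_ae {n : ℕ} : UnitCell n =ᵐ[volume] Set.Icc (0 : Fin n → ℝ) 1 := by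
  unfold UnitCell
  exact Measure.univ_pi_Ioo_ae_eq_Icc (f := 0) (g := 1)

lemma int_cont {n : ℕ} {f : (Fin n → ℝ) → ℝ} (hf : Continuous f) :
    IntegrableOn f (UnitCell n) := by
  have : IntegrableOn f (Set.Icc 0 1) := hf.continuousOn.integrableOn_compact isCompact_Icc
  exact this.congr_set_ae unitCell_ae

lemma int_pd {n : ℕ} (i : Fin n) {f : (Fin n → ℝ) → ℝ} (hf : ContDiff ℝ (⊤ : ℕ∞) f)
    (hp : PeriodicFn f) : ∫ y in UnitCell n, pd i f y = 0 := by
  cases n with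
  | zero => exact i.elim0
  | succ n =>
    rw [setIntegral_congr_set unitCell_ae]
    have hdiff := hf.differentiable (by simp)
    have hpc := (pd_contDiff i hf).continuous
    have hsum : ∀ x, ∑ k, (if k = i then fderiv ℝ f x else 0 :
        (Fin (n+1) → ℝ) →L[ℝ] ℝ) (Pi.single k 1) = pd i f x := by
      intro x
      rw [Finset.sum_eq_single i]
      · simp [pd]
      · intro b _ hb
        simp [hb]
      · simp
    have := integral_divergence_of_hasFDerivAt_off_countable' (0 : Fin (n+1) → ℝ) 1
      (fun _ => zero_le_one) (fun k x => if k = i then f x else 0)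
      (fun k x => if k = i then fderiv ℝ f x else 0) ∅ Set.countable_empty
      (by
        intro k
        by_cases h : k = i
        · simpa [h] using hf.continuous.continuousOn
        · simpa [h] using continuousOn_const)
      (by
        intro x _ k
        by_cases h : k = i
        · simpa [h] using (hdiff x).hasFDerivAt
        · simpa [h] using hasFDerivAt_const (0:ℝ) x)
      (by
        simp only [hsum]
        exact hpc.continuousOn.integrableOn_compact isCompact_Icc)
    simp only [hsum] at this
    rw [this]
    apply Finset.sum_eq_zero
    intro k _
    by_cases h : k = i
    · subst h
      simp only [if_true]
      rw [sub_eq_zero]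
      congr 1
      funext x
      have h2 : (k.insertNth ((1 : Fin (n+1) → ℝ) k) x : Fin (n+1) → ℝ)
          = (k.insertNth ((0 : Fin (n+1) → ℝ) k) x : Fin (n+1) → ℝ) + Pi.single k (1:ℝ) := by
        funext l
        refine Fin.succAboveCases k ?_ (fun l => ?_) l
        · simp
        · simp
      rw [h2, hp]
    · simp [h]

lemma int_hess {n : ℕ} {φ : (Fin n → ℝ) → ℝ} (hφ : ContDiff ℝ (⊤ : ℕ∞) φ)
    (hper : PeriodicFn φ) (i j : Fin n) :
    ∫ y in UnitCell n, (pd i (pd j φ) y) ^ 2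
      = ∫ y in UnitCell n, pd i (pd i φ) y * pd j (pd j φ) y := by
  have ci := pd_contDiff i hφ
  have cj := pd_contDiff j hφ
  have cij := pd_contDiff j ci
  have cjj := pd_contDiff j cj
  have pi' := pd_periodic i hper
  have pij := pd_periodic j pi'
  have pjj := pd_periodic j (pd_periodic j hper)
  have c1 : ContDiff ℝ (⊤ : ℕ∞) (fun y => pd i φ y * pd j (pd j φ) y) := ci.mul cjj
  have c2 : ContDiff ℝ (⊤ : ℕ∞) (fun y => pd i φ y * pd j (pd i φ) y) := ci.mul cij
  have e1 := int_pd i c1 (fun x k => by simp only [pi' x k, pjj x k])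
  have e2 := int_pd j c2 (fun x k => by simp only [pi' x k, pij x k])
  have hsub : ∫ y in UnitCell n, (pd i (fun y => pd i φ y * pd j (pd j φ) y) y
      - pd j (fun y => pd i φ y * pd j (pd i φ) y) y) = 0 := by
    rw [integral_sub (int_cont (pd_contDiff i c1).continuous)
      (int_cont (pd_contDiff j c2).continuous), e1, e2, sub_zero]
  have hcomm : pd i (pd j (pd j φ)) = pd j (pd j (pd i φ)) := by
    rw [pd_comm i j cj, pd_comm i j hφ]
  have hpt : ∀ y, pd i (fun y => pd i φ y * pd j (pd j φ) y) y
      - pd j (fun y => pd i φ y * pd j (pd i φ) y) y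
      = pd i (pd i φ) y * pd j (pd j φ) y - (pd i (pd j φ) y) ^ 2 := by
    intro y
    rw [pd_mul i ci cjj, pd_mul j ci cij, hcomm, pd_comm i j hφ]
    ring
  simp only [hpt] at hsub
  rw [integral_sub (int_cont ((pd_contDiff i ci).mul cjj).continuous)
    (int_cont ((pd_contDiff i cj).pow 2).continuous)] at hsub
  linarith

lemma int_hess_lap {n : ℕ} {φ : (Fin n → ℝ) → ℝ} (hφ : ContDiff ℝ (⊤ : ℕ∞) φ)
    (hper : PeriodicFn φ) :
    ∫ y in UnitCell n, ∑ i, ∑ j, (pd i (pd j φ) y) ^ 2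
      = ∫ y in UnitCell n, (lap φ y) ^ 2 := by
  have c : ∀ i j, ContDiff ℝ (⊤ : ℕ∞) (pd i (pd j φ)) :=
    fun i j => pd_contDiff i (pd_contDiff j hφ)
  have hl : ∀ y, (lap φ y) ^ 2 = ∑ i, ∑ j, pd i (pd i φ) y * pd j (pd j φ) y := by
    intro y
    rw [sq, lap, Finset.sum_mul_sum]
  simp only [hl]
  rw [integral_finsetSum _ fun i _ => integrable_finsetSum _ fun j _ =>
      int_cont ((c i j).pow 2).continuous,
    integral_finsetSum _ fun i _ => integrable_finsetSum _ fun j _ =>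
      int_cont ((c i i).mul (c j j)).continuous]
  refine Finset.sum_congr rfl fun i _ => ?_
  rw [integral_finsetSum _ fun j _ => int_cont ((c i j).pow 2).continuous,
    integral_finsetSum _ fun j _ => int_cont ((c i i).mul (c j j)).continuous]
  exact Finset.sum_congr rfl fun j _ => int_hess hφ hper i j

/-- Coercivity of the bilinear form `b₀` under the pointwise Cordes-type bound
`|γA − I_n| ≤ √(1−δ)` a.e. -/
theorem stmt4 {n : ℕ} (δ : ℝ) (hδ : δ ∈ Set.Ioc (0:ℝ) 1)
    (A : (Fin n → ℝ) → Matrix (Fin n) (Fin n) ℝ) (γ : (Fin n → ℝ) → ℝ)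
    (hAm : ∀ i j, Measurable fun y => A y i j) (hγm : Measurable γ)
    (hγb : ∃ C : ℝ, ∀ y, |γ y| ≤ C)
    (hsym : ∀ y, (A y).IsSymm)
    (hCordes : ∀ᵐ y : Fin n → ℝ,
      Real.sqrt (∑ i, ∑ j, (γ y * A y i j - (1 : Matrix (Fin n) (Fin n) ℝ) i j) ^ 2)
        ≤ Real.sqrt (1 - δ))
    (φ : (Fin n → ℝ) → ℝ) (hφ : ContDiff ℝ (⊤ : ℕ∞) φ) (hper : PeriodicFn φ) :
    ∫ y in UnitCell n, (lap φ y) ^ 2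
      ≤ (1 - Real.sqrt (1 - δ))⁻¹ *
        ∫ y in UnitCell n, (γ y * ∑ i, ∑ j, A y i j * pd i (pd j φ) y) * lap φ y := by
  set s := Real.sqrt (1 - δ) with hs
  have hs0 : 0 ≤ s := Real.sqrt_nonneg _
  have hs1 : s < 1 := by
    rw [hs, Real.sqrt_lt' one_pos]
    linarith [hδ.1]
  have c : ∀ i j, ContDiff ℝ (⊤ : ℕ∞) (pd i (pd j φ)) :=
    fun i j => pd_contDiff i (pd_contDiff j hφ)
  have cl : Continuous (lap φ) := by
    unfold lap
    exact continuous_finsetSum _ fun i _ => (c i i).continuous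
  have ch : Continuous (fun y => ∑ i, ∑ j, (pd i (pd j φ) y) ^ 2) :=
    continuous_finsetSum _ fun i _ => continuous_finsetSum _ fun j _ =>
      ((c i j).continuous.pow 2)
  set X : (Fin n → ℝ) → ℝ :=
    fun y => (γ y * ∑ i, ∑ j, A y i j * pd i (pd j φ) y) * lap φ y with hX
  have hXm : Measurable X := by
    refine (hγm.mul ?_).mul cl.measurable
    exact Finset.measurable_fun_sum _ fun i _ => Finset.measurable_fun_sum _ fun j _ =>
      (hAm i j).mul (c i j).continuous.measurable
  have hbound : ∀ᵐ y : Fin n → ℝ, |X y - lap φ y ^ 2|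
      ≤ s / 2 * ((∑ i, ∑ j, (pd i (pd j φ) y) ^ 2) + lap φ y ^ 2) := by
    filter_upwards [hCordes] with y hy
    set H := ∑ i, ∑ j, (pd i (pd j φ) y) ^ 2 with hH
    have hH0 : 0 ≤ H := Finset.sum_nonneg fun i _ => Finset.sum_nonneg fun j _ => sq_nonneg _
    set B : Fin n → Fin n → ℝ :=
      fun i j => γ y * A y i j - (1 : Matrix (Fin n) (Fin n) ℝ) i j with hB
    set S := ∑ i, ∑ j, B i j * pd i (pd j φ) y with hS
    have hlap : lap φ y = ∑ i, ∑ j, (1 : Matrix (Fin n) (Fin n) ℝ) i j * pd i (pd j φ) y := by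
      simp [lap, Matrix.one_apply]
    have hXS : X y - lap φ y ^ 2 = S * lap φ y := by
      have : S = γ y * (∑ i, ∑ j, A y i j * pd i (pd j φ) y) - lap φ y := by
        rw [hlap, hS, Finset.mul_sum, ← Finset.sum_sub_distrib]
        refine Finset.sum_congr rfl fun i _ => ?_
        rw [Finset.mul_sum, ← Finset.sum_sub_distrib]
        refine Finset.sum_congr rfl fun j _ => ?_
        simp only [hB]
        ring
      rw [this, hX]
      ring
    have hCS : S ^ 2 ≤ (∑ i, ∑ j, B i j ^ 2) * H := by
      have := Finset.sum_mul_sq_le_sq_mul_sq (Finset.univ : Finset (Fin n × Fin n))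
        (fun p => B p.1 p.2) (fun p => pd p.1 (pd p.2 φ) y)
      simpa only [Fintype.sum_prod_type] using this
    have hBs : ∑ i, ∑ j, B i j ^ 2 ≤ s ^ 2 := by
      rw [Real.sqrt_le_left hs0] at hy
      exact hy
    have hS2 : S ^ 2 ≤ (s * Real.sqrt H) ^ 2 := by
      rw [mul_pow, Real.sq_sqrt hH0]
      exact hCS.trans (mul_le_mul_of_nonneg_right hBs hH0)
    have hSa : |S| ≤ s * Real.sqrt H := abs_le_of_sq_le_sq hS2 (by positivity)
    rw [hXS, abs_mul]
    calc |S| * |lap φ y| ≤ s * Real.sqrt H * |lap φ y| := by gcongr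
      _ ≤ s / 2 * (H + lap φ y ^ 2) := by
        have h1 := sq_nonneg (Real.sqrt H - |lap φ y|)
        rw [sub_sq, Real.sq_sqrt hH0, sq_abs] at h1
        nlinarith
  have iL : IntegrableOn (fun y => lap φ y ^ 2) (UnitCell n) := int_cont (cl.pow 2)
  have iR : IntegrableOn (fun y => s / 2 * ((∑ i, ∑ j, (pd i (pd j φ) y) ^ 2) + lap φ y ^ 2))
      (UnitCell n) := int_cont (continuous_const.mul (ch.add (cl.pow 2)))
  have hb' := ae_restrict_of_ae (s := UnitCell n) hbound
  have iD : IntegrableOn (fun y => X y - lap φ y ^ 2) (UnitCell n) :=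
    Integrable.mono' iR (hXm.sub (cl.pow 2).measurable).aestronglyMeasurable hb'
  have iX : IntegrableOn X (UnitCell n) := by
    have := iD.add iL
    refine this.congr (Filter.Eventually.of_forall fun y => ?_)
    simp
  have hmono : ∫ y in UnitCell n, (lap φ y ^ 2 - X y)
      ≤ ∫ y in UnitCell n, s / 2 * ((∑ i, ∑ j, (pd i (pd j φ) y) ^ 2) + lap φ y ^ 2) := by
    refine integral_mono_ae (Integrable.sub iL iX) iR ?_
    filter_upwards [hb'] with y hy
    have := neg_abs_le (X y - lap φ y ^ 2)
    linarith
  rw [integral_sub iL iX, integral_const_mul, integral_add (int_cont ch) iL,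
    int_hess_lap hφ hper] at hmono
  rw [inv_mul_eq_div, le_div_iff₀ (by linarith)]
  linarith
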